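/- Let E be a strongly connected directed graph with finitely many vertices and let c : E¹ → ℤ be the labelling c(e) = 1 for all edges e. Then each connected component of the skew product graph E ×_c ℤ is cofinal: for every infinite path x̃ in E ×_c ℤ and every vertex (v,m) lying in the same connected component as the source of x̃, there exist n ≥ 1 and a path in E ×_c ℤ from (v,m) to r(x̃_n). -/

import Mathlib

/-- A directed graph with vertex type `V` and edge type `E`. -/
structure DiGraph (V : Type) (E : Type) where
  s : E → V
  r : E → V

namespace DiGraph

variable {V E : Type} (G : DiGraph V E)

/-- A dart is an edge traversed forwards (`inl`) or backwards (`inr`). -/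
def dartS : E ⊕ E → V := fun d => match d with | .inl e => G.s e | .inr e => G.r e

def dartR : E ⊕ E → V := fun d => match d with | .inl e => G.r e | .inr e => G.s e

/-- `l` is a walk (as a list of darts). -/
def IsWalk (l : List (E ⊕ E)) : Prop := l.Chain' (fun d d' => G.dartR d = G.dartS d')

/-- `l` is a walk from `v` to `w`. -/
def IsWalkFrom (v w : V) (l : List (E ⊕ E)) : Prop :=
  G.IsWalk l ∧ (∀ d ∈ l.head?, G.dartS d = v) ∧ (∀ d ∈ l.getLast?, G.dartR d = w) ∧
    (l = [] → v = w)

/-- `l` is a (directed) path, as a list of edges. -/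
def IsPath (l : List E) : Prop := l.Chain' (fun e e' => G.r e = G.s e')

/-- `l` is a path from `v` to `w` (vertices count as paths of length `0`). -/
def IsPathFrom (v w : V) (l : List E) : Prop :=
  G.IsPath l ∧ (∀ e ∈ l.head?, G.s e = v) ∧ (∀ e ∈ l.getLast?, G.r e = w) ∧
    (l = [] → v = w)

/-- An infinite path. -/
def IsInfPath (x : ℕ → E) : Prop := ∀ i, G.r (x i) = G.s (x (i + 1))

/-- The graph is cofinal. -/
def Cofinal : Prop :=
  ∀ x : ℕ → E, G.IsInfPath x → ∀ v : V, ∃ n : ℕ, ∃ l : List E, G.IsPathFrom v (G.r (x n)) l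

/-- The graph is strongly connected. -/
def StronglyConnected : Prop :=
  ∀ v w : V, ∃ l : List E, l ≠ [] ∧ G.IsPathFrom v w l

/-- The set of lengths of loops based at `v`. -/
def loopLengths (v : V) : Set ℕ :=
  {n | 0 < n ∧ ∃ l : List E, l.length = n ∧ G.IsPathFrom v v l}

/-- Two vertices are joined by a walk. -/
def Reachable (v w : V) : Prop := ∃ l : List (E ⊕ E), G.IsWalkFrom v w l

/-- The graph is connected. -/
def Connected : Prop := ∀ v w : V, G.Reachable v w

end DiGraph

/-- `d` is the greatest common divisor of the set `S` of natural numbers. -/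
def IsGcdOf (d : ℕ) (S : Set ℕ) : Prop :=
  (∀ n ∈ S, d ∣ n) ∧ ∀ k : ℕ, (∀ n ∈ S, k ∣ n) → k ∣ d

/-- The skew product graph `E ×_c Γ`. -/
def DiGraph.skew {V E : Type} (G : DiGraph V E) (Γ : Type) [Group Γ] (c : E → Γ) :
    DiGraph (V × Γ) (E × Γ) where
  s := fun x => (G.s x.1, x.2)
  r := fun x => (G.r x.1, x.2 * c x.1)

/-- The label of a walk: the product of the labels of its darts. -/
def cWalk {E Γ : Type} [Group Γ] (c : E → Γ) (l : List (E ⊕ E)) : Γ :=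
  (l.map (fun d => match d with | .inl e => c e | .inr e => (c e)⁻¹)).prod

/-- The local voltage group of `c` based at `v`, as a set. -/
def voltage {V E : Type} (G : DiGraph V E) {Γ : Type} [Group Γ] (c : E → Γ) (v : V) : Set Γ :=
  {g | ∃ l : List (E ⊕ E), G.IsWalkFrom v v l ∧ cWalk c l = g}

/-- The skew product graph `E ×_c ℤ` for the canonical labelling `c(e) = 1`. -/
def DiGraph.skewZ {V E : Type} (G : DiGraph V E) : DiGraph (V × ℤ) (E × ℤ) where
  s := fun x => (G.s x.1, x.2)
  r := fun x => (G.r x.1, x.2 + 1)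

namespace DiGraph

theorem isPath_iff {V E : Type} (G : DiGraph V E) {l : List E} :
    G.IsPath l ↔ l.IsChain fun e e' => G.r e = G.s e' := Iff.rfl

theorem isWalk_iff {V E : Type} (G : DiGraph V E) {l : List (E ⊕ E)} :
    G.IsWalk l ↔ l.IsChain fun d d' => G.dartR d = G.dartS d' := Iff.rfl

theorem isPathFrom_nil {V E : Type} (G : DiGraph V E) {v w : V} :
    G.IsPathFrom v w [] ↔ v = w := by
  simp [IsPathFrom, isPath_iff]

theorem isPathFrom_cons {V E : Type} (G : DiGraph V E) {v w : V} {e : E} {l : List E} :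
    G.IsPathFrom v w (e :: l) ↔ G.s e = v ∧ G.IsPathFrom (G.r e) w l := by
  cases l with
  | nil => simp [IsPathFrom, isPath_iff]
  | cons e' l =>
    simp only [IsPathFrom, isPath_iff, List.isChain_cons_cons, List.head?_cons,
      Option.mem_def, Option.some.injEq, forall_eq', List.getLast?_cons_cons, reduceCtorEq,
      false_implies, and_true]
    grind

theorem isWalkFrom_nil {V E : Type} (G : DiGraph V E) {v w : V} :
    G.IsWalkFrom v w [] ↔ v = w := by
  simp [IsWalkFrom, isWalk_iff]

theorem isWalkFrom_cons {V E : Type} (G : DiGraph V E) {v w : V} {d : E ⊕ E}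
    {l : List (E ⊕ E)} :
    G.IsWalkFrom v w (d :: l) ↔ G.dartS d = v ∧ G.IsWalkFrom (G.dartR d) w l := by
  cases l with
  | nil => simp [IsWalkFrom, isWalk_iff]
  | cons d' l =>
    simp only [IsWalkFrom, isWalk_iff, List.isChain_cons_cons, List.head?_cons,
      Option.mem_def, Option.some.injEq, forall_eq', List.getLast?_cons_cons, reduceCtorEq,
      false_implies, and_true]
    grind

theorem IsPathFrom.append {V E : Type} {G : DiGraph V E} {u v w : V} {l l' : List E}
    (h : G.IsPathFrom u v l) (h' : G.IsPathFrom v w l') : G.IsPathFrom u w (l ++ l') := by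
  induction l generalizing u with
  | nil => rw [isPathFrom_nil] at h; simpa [h] using h'
  | cons e l ih =>
    rw [isPathFrom_cons] at h
    exact G.isPathFrom_cons.2 ⟨h.1, ih h.2⟩

/-- A function on the vertices that is constant along edges is constant along walks. -/
theorem Reachable.apply_eq {V E α : Type} {G : DiGraph V E} (f : V → α)
    (hf : ∀ e, f (G.s e) = f (G.r e)) {v w : V} (h : G.Reachable v w) : f v = f w := by
  obtain ⟨l, hl⟩ := h
  induction l generalizing v with
  | nil => rw [G.isWalkFrom_nil.1 hl]
  | cons d l ih =>
    obtain ⟨rfl, hl'⟩ := G.isWalkFrom_cons.1 hl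
    rw [← ih hl']
    cases d with
    | inl e => exact hf e
    | inr e => exact (hf e).symm

/-- Every path lifts to the skew product, starting from any level. -/
theorem IsPathFrom.exists_skewZ {V E : Type} {G : DiGraph V E} {v w : V} {l : List E}
    (h : G.IsPathFrom v w l) (m : ℤ) :
    ∃ l', G.skewZ.IsPathFrom (v, m) (w, m + l.length) l' := by
  induction l generalizing v m with
  | nil => exact ⟨[], by simpa [isPathFrom_nil] using h⟩
  | cons e l ih =>
    obtain ⟨rfl, ht⟩ := G.isPathFrom_cons.1 h
    obtain ⟨l', hl'⟩ := ih ht (m + 1)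
    refine ⟨(e, m) :: l', G.skewZ.isPathFrom_cons.2 ⟨rfl, ?_⟩⟩
    have key : m + ((e :: l).length : ℤ) = m + 1 + l.length := by
      push_cast [List.length_cons]; ring
    rw [key]
    exact hl'

/-- The additive submonoid of lengths of closed paths at `u`. -/
def closedPathLengths {V E : Type} (G : DiGraph V E) (u : V) : AddSubmonoid ℕ where
  carrier := {n | ∃ l : List E, l.length = n ∧ G.IsPathFrom u u l}
  zero_mem' := ⟨[], rfl, G.isPathFrom_nil.2 rfl⟩
  add_mem' := by
    rintro _ _ ⟨l, rfl, hl⟩ ⟨l', rfl, hl'⟩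
    exact ⟨l ++ l', List.length_append, hl.append hl'⟩

/-- The lengths of two paths with the same endpoints are congruent modulo the period. -/
theorem IsPathFrom.length_modEq {V E : Type} {G : DiGraph V E} (hsc : G.StronglyConnected)
    {u w : V} {l l' : List E} (h : G.IsPathFrom w u l) (h' : G.IsPathFrom w u l') :
    l.length ≡ l'.length [MOD Nat.setGcd (G.closedPathLengths u : Set ℕ)] := by
  obtain ⟨p, -, hp⟩ := hsc u w
  have dvd {q : List E} (hq : G.IsPathFrom w u q) :
      Nat.setGcd (G.closedPathLengths u : Set ℕ) ∣ p.length + q.length :=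
    Nat.setGcd_dvd_of_mem ⟨p ++ q, List.length_append, hp.append hq⟩
  exact Nat.ModEq.add_left_cancel' p.length
    ((Nat.modEq_zero_iff_dvd.2 (dvd h)).trans (Nat.modEq_zero_iff_dvd.2 (dvd h')).symm)

theorem IsInfPath.skewZ_snd {V E : Type} {G : DiGraph V E} {x : ℕ → E × ℤ}
    (hx : G.skewZ.IsInfPath x) (n : ℕ) : (x n).2 = (x 0).2 + n := by
  induction n with
  | zero => simp
  | succ n ih =>
    have h : (x n).2 + 1 = (x (n + 1)).2 := congrArg Prod.snd (hx n)
    push_cast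
    linarith

end DiGraph

/-- If `E` is strongly connected with finitely many vertices, then
every connected component of `E ×_c ℤ` (with `c(e) = 1`) is cofinal: for every infinite
path `x̃` in `E ×_c ℤ` and every vertex `(v,m)` in the same connected component as the
source of `x̃`, some vertex `r(x̃_n)` of `x̃` can be reached from `(v,m)` by a path. -/
theorem skewZ_components_cofinal
    {V E : Type} [Finite V] (G : DiGraph V E) (hsc : G.StronglyConnected)
    (x : ℕ → E × ℤ) (hx : G.skewZ.IsInfPath x) (v : V) (m : ℤ)
    (hcomp : G.skewZ.Reachable (v, m) (G.skewZ.s (x 0))) :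
    ∃ n : ℕ, ∃ l : List (E × ℤ), G.skewZ.IsPathFrom (v, m) (G.skewZ.r (x n)) l := by
  obtain ⟨u, hu⟩ := Finite.exists_infinite_fiber fun n => G.r (x n).1
  rw [Set.infinite_coe_iff] at hu
  set d := Nat.setGcd (G.closedPathLengths u : Set ℕ)
  choose p _ hp using fun w => hsc w u
  -- The distance to `u` plus the level is constant modulo the period on components.
  let φ : V × ℤ → ZMod d := fun a => ((p a.1).length : ZMod d) + a.2
  have hφ : ∀ e, φ (G.skewZ.s e) = φ (G.skewZ.r e) := by
    rintro ⟨e, k⟩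
    have h := (ZMod.natCast_eq_natCast_iff _ _ d).2
      ((hp (G.s e)).length_modEq hsc (G.isPathFrom_cons.2 ⟨rfl, hp (G.r e)⟩))
    simp only [φ, DiGraph.skewZ, h]
    push_cast [List.length_cons]
    ring
  have hinf : ∀ n, φ (G.skewZ.s (x 0)) = φ (G.skewZ.r (x n)) := by
    intro n
    induction n with
    | zero => exact hφ _
    | succ n ih => rw [ih, hx n, hφ]
  obtain ⟨N, hN⟩ := Nat.exists_mem_closure_of_ge (G.closedPathLengths u : Set ℕ)
  obtain ⟨n, hn, hlt⟩ := hu.exists_gt (N + (p v).length + (m - (x 0).2).toNat)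
  replace hn : G.r (x n).1 = u := hn
  have hr : G.skewZ.r (x n) = (u, (x 0).2 + n + 1) := by
    rw [← hx.skewZ_snd n, ← hn]; rfl
  obtain ⟨t, ht⟩ := Int.eq_ofNat_of_zero_le
    (show 0 ≤ (x 0).2 + n + 1 - m - (p v).length by omega)
  have hdvd : d ∣ t := by
    have h := (hcomp.apply_eq φ hφ).trans (hinf n)
    have hzero : ((p u).length : ZMod d) = 0 :=
      (ZMod.natCast_eq_zero_iff _ _).2 (Nat.setGcd_dvd_of_mem ⟨p u, rfl, hp u⟩)
    rw [hr] at h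
    simp only [φ, hzero] at h
    have h' := congrArg (Int.cast : ℤ → ZMod d) ht
    rw [← ZMod.natCast_eq_zero_iff]
    push_cast at h h'
    linear_combination -h - h'
  have hmem := hN t (by omega) hdvd
  rw [AddSubmonoid.closure_eq] at hmem
  obtain ⟨q, hq, hqu⟩ := hmem
  obtain ⟨l, hl⟩ := ((hp v).append hqu).exists_skewZ m
  refine ⟨n, l, ?_⟩
  have hlevel : (x 0).2 + n + 1 = m + ((p v ++ q).length : ℤ) := by
    rw [List.length_append]; omega
  rwa [hr, hlevel]
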